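/- Let (W,S) be a Coxeter system with S finite, let 𝒮 be the set of spherical subsets of S, and for T ∈ 𝒮 let w_T be the longest element of W_T. For w ∈ W set In(w) := {s ∈ S : ℓ(ws) < ℓ(w)}. Then for each T ∈ 𝒮, in ℚ[[t]]: Σ_{w∈W, In(w)=T} t^{ℓ(w)} = Σ_{U∈𝒮, T⊆U} (−1)^{Card U − Card T} · t^{ℓ(w_U)} · (Σ_{w∈W} t^{ℓ(w)}) · (Σ_{w∈W_U} t^{ℓ(w)})⁻¹. (Steinberg's formula W^T(t)/W(t) = Σ_{U⊇T, U∈𝒮} (−1)^{Card(U−T)}/W_U(t⁻¹), in single-parameter power-series form.) -/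

import Mathlib

namespace CoxeterSystem

variable {B : Type*} {W : Type*} [Group W] {M : CoxeterMatrix B} (cs : CoxeterSystem M W)

section Inversions

open scoped Classical in
/-- The action of a simple reflection on `W × ZMod 2` by conjugation on the first factor, flipping
the second factor exactly at the simple reflection itself. -/
noncomputable def inversionStep (i : B) : Function.End (W × ZMod 2) := fun p =>
  (cs.simple i * p.1 * (cs.simple i)⁻¹, p.2 + if cs.simple i = p.1 then 1 else 0)

open scoped Classical in
theorem prod_map_inversionStep (ω : List B) (p : W × ZMod 2) :
    (ω.map cs.inversionStep).prod p =
      (cs.wordProd ω * p.1 * (cs.wordProd ω)⁻¹,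
        p.2 + ((cs.rightInvSeq ω).count p.1 : ZMod 2)) := by
  induction ω with
  | nil => simp [Function.End.one_def]
  | cons i ω ih =>
    rw [List.map_cons, List.prod_cons]
    change cs.inversionStep i ((ω.map cs.inversionStep).prod p) = _
    rw [ih]
    simp only [inversionStep, rightInvSeq, List.count_cons, cs.wordProd_cons, Prod.mk.injEq]
    refine ⟨by group, ?_⟩
    have : cs.simple i = cs.wordProd ω * p.1 * (cs.wordProd ω)⁻¹ ↔
        (cs.wordProd ω)⁻¹ * cs.simple i * cs.wordProd ω = p.1 := by
      constructor
      · intro h; rw [h]; group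
      · intro h; rw [← h]; group
    by_cases h : cs.simple i = cs.wordProd ω * p.1 * (cs.wordProd ω)⁻¹
    · simp [this.1 h, ← h, add_assoc]
    · simp [h, mt this.2 h]

open scoped Classical in
theorem even_count_leftInvSeq_alternatingWord (i j : B) (t : W) :
    Even ((cs.leftInvSeq (alternatingWord i j (2 * M i j))).count t) := by
  set L := cs.leftInvSeq (alternatingWord i j (2 * M i j)) with hL
  have hlen : L.length = 2 * M i j := by simp [hL]
  have h : L.drop (M i j) = L.take (M i j) := by
    apply List.ext_getElem
    · simp [hlen]; omega
    · intro k h₁ h₂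
      have hk : k < M i j := by simp [hlen] at h₂; omega
      rw [List.getElem_drop, List.getElem_take]
      simp only [hL]
      rw [cs.getElem_leftInvSeq_alternatingWord i j (M i j) (M i j + k) (by omega),
        cs.getElem_leftInvSeq_alternatingWord i j (M i j) k (by omega),
        cs.prod_alternatingWord_eq_mul_pow, cs.prod_alternatingWord_eq_mul_pow]
      have h₃ : (2 * (M i j + k) + 1) / 2 = M i j + k := by omega
      have h₄ : (2 * k + 1) / 2 = k := by omega
      simp [h₃, h₄, pow_add]
  rw [← List.take_append_drop (M i j) L, h, List.count_append]
  exact ⟨_, rfl⟩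

theorem isLiftable_inversionStep : M.IsLiftable cs.inversionStep := by
  classical
  intro i j
  have h : ∀ m, ((alternatingWord j i (2 * m)).reverse.map cs.inversionStep).prod =
      (cs.inversionStep i * cs.inversionStep j) ^ m := by
    intro m
    induction m with
    | zero => simp [alternatingWord]
    | succ m ih =>
      rw [mul_add, mul_one, alternatingWord_succ, alternatingWord_succ]
      simp only [List.concat_eq_append, List.reverse_append, List.map_append, List.prod_append, ih]
      simp [pow_succ', mul_assoc]
  rw [← h]
  funext p
  rw [prod_map_inversionStep, rightInvSeq_reverse, List.count_reverse, M.symmetric i j,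
    (ZMod.natCast_eq_zero_iff_even).2 (cs.even_count_leftInvSeq_alternatingWord j i p.1),
    wordProd_reverse, prod_alternatingWord_eq_mul_pow]
  simp [Function.End.one_def]

/-- The number, modulo two, of occurrences of `t` in the right inversion sequence of any word
for `w`. -/
noncomputable def inversionParity (w t : W) : ZMod 2 :=
  (cs.lift ⟨cs.inversionStep, cs.isLiftable_inversionStep⟩ w (t, 0)).2

open scoped Classical in
theorem lift_inversionStep_wordProd (ω : List B) (p : W × ZMod 2) :
    cs.lift ⟨cs.inversionStep, cs.isLiftable_inversionStep⟩ (cs.wordProd ω) p =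
      (cs.wordProd ω * p.1 * (cs.wordProd ω)⁻¹,
        p.2 + ((cs.rightInvSeq ω).count p.1 : ZMod 2)) := by
  rw [← prod_map_inversionStep, wordProd, map_list_prod, List.map_map]
  have h : ω.map (cs.lift ⟨cs.inversionStep, cs.isLiftable_inversionStep⟩ ∘ cs.simple) =
      ω.map cs.inversionStep :=
    List.map_congr_left fun i _ => cs.lift_apply_simple cs.isLiftable_inversionStep i
  rw [h]

open scoped Classical in
theorem inversionParity_wordProd (ω : List B) (t : W) :
    cs.inversionParity (cs.wordProd ω) t = ((cs.rightInvSeq ω).count t : ZMod 2) := by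
  simp [inversionParity, lift_inversionStep_wordProd]

theorem lift_inversionStep_apply (w : W) (p : W × ZMod 2) :
    cs.lift ⟨cs.inversionStep, cs.isLiftable_inversionStep⟩ w p =
      (w * p.1 * w⁻¹, p.2 + cs.inversionParity w p.1) := by
  obtain ⟨ω, rfl⟩ := cs.wordProd_surjective w
  rw [lift_inversionStep_wordProd, inversionParity_wordProd]

theorem inversionParity_mul (x y t : W) :
    cs.inversionParity (x * y) t =
      cs.inversionParity x (y * t * y⁻¹) + cs.inversionParity y t := by
  rw [inversionParity, map_mul]
  change (cs.lift ⟨cs.inversionStep, cs.isLiftable_inversionStep⟩ x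
    (cs.lift ⟨cs.inversionStep, cs.isLiftable_inversionStep⟩ y (t, 0))).2 = _
  simp [lift_inversionStep_apply, add_comm]

theorem inversionParity_mul_simple (w : W) (i : B) :
    cs.inversionParity (w * cs.simple i) (cs.simple i) =
      cs.inversionParity w (cs.simple i) + 1 := by
  classical
  have h := cs.inversionParity_wordProd [i] (cs.simple i)
  rw [wordProd_singleton] at h
  rw [inversionParity_mul, h]
  simp

theorem mem_rightInvSeq_of_inversionParity_ne_zero {ω : List B} {t : W}
    (h : cs.inversionParity (cs.wordProd ω) t ≠ 0) : t ∈ cs.rightInvSeq ω := by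
  classical
  rw [inversionParity_wordProd] at h
  by_contra ht
  exact h (by simp [List.count_eq_zero_of_not_mem ht])

theorem length_mul_lt_of_inversionParity_ne_zero {w t : W} (h : cs.inversionParity w t ≠ 0) :
    cs.length (w * t) < cs.length w := by
  obtain ⟨ω, hω, rfl⟩ := cs.exists_isReduced w
  exact (cs.isRightInversion_of_mem_rightInvSeq hω
    (cs.mem_rightInvSeq_of_inversionParity_ne_zero h)).2

theorem inversionParity_simple_ne_zero_iff {w : W} {i : B} :
    cs.inversionParity w (cs.simple i) ≠ 0 ↔ cs.IsRightDescent w i := by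
  refine ⟨cs.length_mul_lt_of_inversionParity_ne_zero, fun h h₀ => ?_⟩
  have h₁ := cs.inversionParity_mul_simple w i
  rw [h₀, zero_add] at h₁
  have h₂ := cs.length_mul_lt_of_inversionParity_ne_zero (h₁ ▸ one_ne_zero)
  rw [simple_mul_simple_cancel_right] at h₂
  exact lt_asymm h h₂

/-- The exchange property, for an arbitrary word. -/
theorem exists_wordProd_mul_simple_eq_eraseIdx {ω : List B} {i : B}
    (h : cs.IsRightDescent (cs.wordProd ω) i) :
    ∃ j < ω.length, cs.wordProd ω * cs.simple i = cs.wordProd (ω.eraseIdx j) := by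
  obtain ⟨j, hj, hji⟩ := List.mem_iff_getElem.mp
    (cs.mem_rightInvSeq_of_inversionParity_ne_zero (cs.inversionParity_simple_ne_zero_iff.2 h))
  refine ⟨j, by simpa using hj, ?_⟩
  rw [← wordProd_mul_getD_rightInvSeq, List.getD_eq_getElem _ 1 hj, hji]

end Inversions

section Parabolic

/-- The standard parabolic subgroup generated by the simple reflections indexed by `U`. -/
def parabolic (U : Set B) : Subgroup W := Subgroup.closure (cs.simple '' U)

variable {cs} {U : Set B}

theorem simple_mem_parabolic {i : B} (hi : i ∈ U) : cs.simple i ∈ cs.parabolic U :=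
  Subgroup.subset_closure ⟨i, hi, rfl⟩

theorem exists_word_of_mem_parabolic {x : W} (hx : x ∈ cs.parabolic U) :
    ∃ ω : List B, (∀ i ∈ ω, i ∈ U) ∧ cs.wordProd ω = x := by
  induction hx using Subgroup.closure_induction with
  | mem x hx =>
    obtain ⟨i, hi, rfl⟩ := hx
    exact ⟨[i], by simpa using hi, by simp⟩
  | one => exact ⟨[], by simp, by simp⟩
  | mul x y _ _ hx hy =>
    obtain ⟨ω, h, rfl⟩ := hx
    obtain ⟨ω', h', rfl⟩ := hy
    refine ⟨ω ++ ω', fun i hi => ?_, wordProd_append _ _ _⟩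
    exact (List.mem_append.1 hi).elim (h i) (h' i)
  | inv x _ hx =>
    obtain ⟨ω, h, rfl⟩ := hx
    exact ⟨ω.reverse, by simpa using h, wordProd_reverse _ _⟩

theorem exists_rightDescent_of_mem_parabolic {x : W} (hx : x ∈ cs.parabolic U) (hx₁ : x ≠ 1) :
    ∃ i ∈ U, cs.IsRightDescent x i := by
  obtain ⟨ω, hω, rfl⟩ := exists_word_of_mem_parabolic hx
  clear hx
  induction hn : ω.length using Nat.strong_induction_on generalizing ω with
  | _ n ih =>
  obtain rfl | ⟨ω', i, rfl⟩ := List.eq_nil_or_concat' ω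
  · simp at hx₁
  have hi : i ∈ U := hω i (by simp)
  by_cases hd : cs.IsRightDescent (cs.wordProd (ω' ++ [i])) i
  · exact ⟨i, hi, hd⟩
  rw [wordProd_append, wordProd_singleton, ← isRightDescent_iff_not_isRightDescent_mul] at hd
  obtain ⟨j, hj, h⟩ := cs.exists_wordProd_mul_simple_eq_eraseIdx hd
  rw [wordProd_append, wordProd_singleton, h] at hx₁ ⊢
  refine ih _ ?_ _ (fun k hk => hω k ?_) hx₁ rfl
  · rw [← hn, List.length_append, List.length_eraseIdx_of_lt hj, List.length_singleton]; omega
  · exact List.mem_append_left _ (List.mem_of_mem_eraseIdx hk)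

/-- Induction along right multiplications that increase the length, within a parabolic
subgroup. -/
theorem parabolic_induction {p : W → Prop} (one : p 1)
    (mul_simple : ∀ x ∈ cs.parabolic U, ∀ i ∈ U, ¬ cs.IsRightDescent x i → p x →
      p (x * cs.simple i)) {x : W} (hx : x ∈ cs.parabolic U) : p x := by
  induction hn : cs.length x using Nat.strong_induction_on generalizing x with
  | _ n ih =>
  by_cases hx₁ : x = 1
  · exact hx₁ ▸ one
  obtain ⟨i, hi, hd⟩ := exists_rightDescent_of_mem_parabolic hx hx₁
  have hxi := mul_mem hx (simple_mem_parabolic hi)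
  have := mul_simple _ hxi i hi (cs.isRightDescent_iff_not_isRightDescent_mul.1 hd)
    (ih _ (hn ▸ hd) hxi rfl)
  rwa [simple_mul_simple_cancel_right] at this

variable (cs U) in
/-- `v` has minimal length in its coset `v W_U`. -/
def IsMinCoset (v : W) : Prop := ∀ u ∈ cs.parabolic U, cs.length v ≤ cs.length (v * u)

theorem IsMinCoset.length_mul {v u : W} (hv : cs.IsMinCoset U v) (hu : u ∈ cs.parabolic U) :
    cs.length (v * u) = cs.length v + cs.length u := by
  refine parabolic_induction (p := fun u => cs.length (v * u) = cs.length v + cs.length u)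
    (by simp) (fun u hu i hi hd ih => ?_) hu
  rw [cs.not_isRightDescent_iff.1 hd, ← add_assoc, ← ih, ← mul_assoc, ← not_isRightDescent_iff,
    ← inversionParity_simple_ne_zero_iff, inversionParity_mul, not_not]
  rw [← inversionParity_simple_ne_zero_iff, not_not] at hd
  rw [hd, add_zero]
  by_contra h
  exact absurd (cs.length_mul_lt_of_inversionParity_ne_zero h)
    (hv _ (mul_mem (mul_mem hu (simple_mem_parabolic hi)) (inv_mem hu))).not_gt

variable (cs U) in
theorem exists_isMinCoset_mul (w : W) :
    ∃ v u, cs.IsMinCoset U v ∧ u ∈ cs.parabolic U ∧ v * u = w := by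
  let f : cs.parabolic U → ℕ := fun u => cs.length (w * u)
  let u := Function.argmin f
  refine ⟨w * u, (u : W)⁻¹, fun x hx => ?_, inv_mem u.2, by group⟩
  have h : f u ≤ f (u * ⟨x, hx⟩) := Function.argmin_le f _
  simpa [f, mul_assoc] using h

theorem IsMinCoset.ext {v v' u u' : W} (hv : cs.IsMinCoset U v) (hv' : cs.IsMinCoset U v')
    (hu : u ∈ cs.parabolic U) (hu' : u' ∈ cs.parabolic U) (h : v * u = v' * u') :
    v = v' ∧ u = u' := by
  have h₁ : v * (u * u'⁻¹) = v' := by rw [← mul_assoc, h]; group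
  have hm := mul_mem hu (inv_mem hu')
  have h₂ := hv.length_mul hm
  have h₃ := hv' _ (inv_mem hm)
  rw [← h₁, mul_assoc, mul_inv_cancel, mul_one, h₂] at h₃
  have h₄ : u * u'⁻¹ = 1 := cs.length_eq_zero_iff.1 (by omega)
  rw [h₄, mul_one] at h₁
  exact ⟨h₁, mul_inv_eq_one.1 h₄⟩

theorem length_eq_add_of_forall_isRightDescent {u x : W} (hu : ∀ i ∈ U, cs.IsRightDescent u i)
    (hx : x ∈ cs.parabolic U) : cs.length u = cs.length (u * x⁻¹) + cs.length x := by
  refine parabolic_induction (p := fun x => cs.length u = cs.length (u * x⁻¹) + cs.length x)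
    (by simp) (fun x hx i hi hd ih => ?_) hx
  have h := cs.inversionParity_simple_ne_zero_iff.2 (hu i hi)
  rw [show u = u * x⁻¹ * x by group, inversionParity_mul,
    not_not.1 (mt cs.inversionParity_simple_ne_zero_iff.1 hd), add_zero] at h
  have h₁ := cs.length_mul_lt_of_inversionParity_ne_zero h
  rw [show u * x⁻¹ * (x * cs.simple i * x⁻¹) = u * (x * cs.simple i)⁻¹ by
    simp [mul_assoc]] at h₁
  have h₂ := cs.length_mul_le (u * (x * cs.simple i)⁻¹) (x * cs.simple i)
  rw [inv_mul_cancel_right] at h₂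
  have h₃ := cs.not_isRightDescent_iff.1 hd
  omega

end Parabolic

section LongestElement

variable {cs} {U : Set B}

theorem IsMinCoset.isRightDescent_mul_iff {v u : W} (hv : cs.IsMinCoset U v)
    (hu : u ∈ cs.parabolic U) {i : B} (hi : i ∈ U) :
    cs.IsRightDescent (v * u) i ↔ cs.IsRightDescent u i := by
  rw [IsRightDescent, IsRightDescent, mul_assoc, hv.length_mul hu,
    hv.length_mul (mul_mem hu (simple_mem_parabolic hi)), add_lt_add_iff_left]

variable (cs) in
theorem finite_length_le [Finite B] (n : ℕ) : {w | cs.length w ≤ n}.Finite := by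
  refine ((List.finite_length_le B n).image cs.wordProd).subset fun w hw => ?_
  obtain ⟨ω, hω, rfl⟩ := cs.exists_isReduced w
  exact ⟨ω, hω.eq.symm.trans_le hw, rfl⟩

theorem finite_parabolic_of_forall_isRightDescent [Finite B] {w : W}
    (hw : ∀ i ∈ U, cs.IsRightDescent w i) : (cs.parabolic U : Set W).Finite :=
  (cs.finite_length_le (cs.length w)).subset fun x hx => by
    have := length_eq_add_of_forall_isRightDescent hw hx
    exact Nat.le_of_add_left_le this.ge

variable (cs U) in
/-- `z` is an element of maximal length in `W_U`. -/
def IsLongest (z : W) : Prop :=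
  z ∈ cs.parabolic U ∧ ∀ v ∈ cs.parabolic U, cs.length v ≤ cs.length z

theorem IsLongest.isRightDescent {z : W} (hz : cs.IsLongest U z) {i : B} (hi : i ∈ U) :
    cs.IsRightDescent z i :=
  lt_of_le_of_ne (hz.2 _ (mul_mem hz.1 (simple_mem_parabolic hi))) (cs.length_mul_simple_ne z i)

theorem IsLongest.eq_of_forall_isRightDescent {z u : W} (hz : cs.IsLongest U z)
    (hu : u ∈ cs.parabolic U) (hd : ∀ i ∈ U, cs.IsRightDescent u i) : u = z := by
  have h₁ := length_eq_add_of_forall_isRightDescent hd hz.1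
  have h₂ := hz.2 u hu
  exact mul_inv_eq_one.1 (cs.length_eq_zero_iff.1 (by omega))

end LongestElement

section Growth

/-- The growth series of the set of elements satisfying `P`. -/
noncomputable def growth (P : W → Prop) : PowerSeries ℚ :=
  PowerSeries.mk fun n => (Nat.card {w : W // P w ∧ cs.length w = n} : ℚ)

variable [Finite B]

/-- The finite set of elements of length `n`. -/
noncomputable def sphere (n : ℕ) : Finset W :=
  Set.Finite.toFinset (s := {w | cs.length w = n})
    ((cs.finite_length_le n).subset fun _ h => Eq.le h)

@[simp]
theorem mem_sphere {n : ℕ} {w : W} : w ∈ cs.sphere n ↔ cs.length w = n := by simp [sphere]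

open scoped Classical in
theorem coeff_growth (P : W → Prop) (n : ℕ) :
    PowerSeries.coeff n (cs.growth P) = (((cs.sphere n).filter P).card : ℚ) := by
  rw [growth, PowerSeries.coeff_mk, Nat.subtype_card]
  simp [and_comm]

variable {cs}

theorem growth_isMinCoset_mul_growth_parabolic (U : Set B) :
    cs.growth (cs.IsMinCoset U) * cs.growth (· ∈ cs.parabolic U) = cs.growth fun _ => True := by
  classical
  ext n
  simp only [PowerSeries.coeff_mul, coeff_growth, ← Nat.cast_mul, ← Nat.cast_sum,
    ← Finset.card_product, ← Finset.card_sigma]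
  congr 1
  refine Finset.card_bij (fun x _ => x.2.1 * x.2.2) ?_ ?_ ?_
  · rintro ⟨⟨a, b⟩, v, u⟩ h
    simp only [Finset.mem_sigma, Finset.HasAntidiagonal.mem_antidiagonal, Finset.mem_product,
      Finset.mem_filter, mem_sphere, and_true] at h ⊢
    obtain ⟨hab, ⟨rfl, hv⟩, rfl, hu⟩ := h
    rw [hv.length_mul hu, hab]
  · rintro ⟨⟨a, b⟩, v, u⟩ h ⟨⟨a', b'⟩, v', u'⟩ h' heq
    simp only [Finset.mem_sigma, Finset.HasAntidiagonal.mem_antidiagonal, Finset.mem_product,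
      Finset.mem_filter, mem_sphere] at h h'
    obtain ⟨_, ⟨rfl, hv⟩, rfl, hu⟩ := h
    obtain ⟨_, ⟨rfl, hv'⟩, rfl, hu'⟩ := h'
    obtain ⟨rfl, rfl⟩ := hv.ext hv' hu hu' heq
    rfl
  · intro w hw
    obtain ⟨v, u, hv, hu, rfl⟩ := cs.exists_isMinCoset_mul U w
    refine ⟨⟨(cs.length v, cs.length u), v, u⟩, ?_, rfl⟩
    simpa [hv, hu, hv.length_mul hu] using hw

theorem constantCoeff_growth_parabolic (U : Set B) :
    PowerSeries.constantCoeff (cs.growth (· ∈ cs.parabolic U)) = 1 := by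
  classical
  rw [← PowerSeries.coeff_zero_eq_constantCoeff_apply, coeff_growth,
    show (cs.sphere 0).filter (· ∈ cs.parabolic U) = {1} from ?_]
  · simp
  · ext w
    simp only [Finset.mem_filter, mem_sphere, length_eq_zero_iff, Finset.mem_singleton]
    exact ⟨And.left, fun h => ⟨h, h ▸ one_mem _⟩⟩

theorem growth_isMinCoset (U : Set B) :
    cs.growth (cs.IsMinCoset U) =
      cs.growth (fun _ => True) * (cs.growth (· ∈ cs.parabolic U))⁻¹ := by
  rw [PowerSeries.eq_mul_inv_iff_mul_eq (by simp [constantCoeff_growth_parabolic]),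
    growth_isMinCoset_mul_growth_parabolic]

theorem growth_forall_isRightDescent {U : Set B} {z : W} (hz : cs.IsLongest U z) :
    cs.growth (fun w => ∀ i ∈ U, cs.IsRightDescent w i) =
      PowerSeries.X ^ cs.length z * cs.growth (cs.IsMinCoset U) := by
  classical
  ext n
  rw [PowerSeries.coeff_X_pow_mul']
  simp only [coeff_growth]
  have key : ∀ w, (∀ i ∈ U, cs.IsRightDescent w i) → ∃ v, cs.IsMinCoset U v ∧ v * z = w := by
    intro w hw
    obtain ⟨v, u, hv, hu, rfl⟩ := cs.exists_isMinCoset_mul U w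
    rw [← hz.eq_of_forall_isRightDescent hu fun i hi =>
      (hv.isRightDescent_mul_iff hu hi).1 (hw i hi)]
    exact ⟨v, hv, rfl⟩
  split_ifs with h
  · congr 1
    symm
    refine Finset.card_bij (fun v _ => v * z) ?_ (fun _ _ _ _ => mul_right_cancel) ?_
    · intro v hv
      simp only [Finset.mem_filter, mem_sphere] at hv ⊢
      refine ⟨by rw [hv.2.length_mul hz.1]; omega, fun i hi => ?_⟩
      exact (hv.2.isRightDescent_mul_iff hz.1 hi).2 (hz.isRightDescent hi)
    · intro w hw
      simp only [Finset.mem_filter, mem_sphere] at hw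
      obtain ⟨v, hv, rfl⟩ := key w hw.2
      rw [hv.length_mul hz.1] at hw
      exact ⟨v, by simp only [Finset.mem_filter, mem_sphere]; exact ⟨by omega, hv⟩, rfl⟩
  · rw [Nat.cast_eq_zero, Finset.card_eq_zero, Finset.filter_eq_empty_iff]
    intro w hw hd
    obtain ⟨v, hv, rfl⟩ := key w hd
    rw [mem_sphere, hv.length_mul hz.1] at hw
    omega

theorem growth_forall_isRightDescent_eq_zero {U : Set B}
    (hU : ¬ (cs.parabolic U : Set W).Finite) :
    cs.growth (fun w => ∀ i ∈ U, cs.IsRightDescent w i) = 0 := by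
  classical
  ext n
  rw [coeff_growth, Finset.filter_false_of_mem fun w _ hw =>
    hU (finite_parabolic_of_forall_isRightDescent hw)]
  simp

end Growth

end CoxeterSystem

theorem Finset.sum_Icc_neg_one_pow_card_sub {α R : Type*} [DecidableEq α] [CommRing R]
    (s t : Finset α) :
    ∑ u ∈ Finset.Icc s t, (-1 : R) ^ (u.card - s.card) = if s = t then 1 else 0 := by
  by_cases hst : s ⊆ t
  · have hdisj : ∀ u ∈ (t \ s).powerset, Disjoint s u := fun u hu =>
      Finset.disjoint_of_subset_right (Finset.mem_powerset.1 hu) Finset.disjoint_sdiff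
    rw [Finset.Icc_eq_image_powerset hst, Finset.sum_image]
    · have h := congrArg (Int.cast : ℤ → R) (Finset.sum_powerset_neg_one_pow_card (x := t \ s))
      push_cast at h
      rw [Finset.sum_congr rfl fun u hu => by
        rw [Finset.card_union_of_disjoint (hdisj u hu), Nat.add_sub_cancel_left], h]
      refine if_congr ?_ rfl rfl
      rw [Finset.sdiff_eq_empty_iff_subset]
      exact ⟨hst.antisymm, fun h => h ▸ subset_rfl⟩
    · intro u hu u' hu' h
      have := congrArg (· \ s) h
      simpa [Finset.union_sdiff_cancel_left (hdisj _ hu),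
        Finset.union_sdiff_cancel_left (hdisj _ hu')] using this
  · rw [Finset.Icc_eq_empty hst, Finset.sum_empty, if_neg fun h => hst h.subset]

open scoped Classical in
theorem CoxeterSystem.growth_rightDescents_eq {B : Type*} [Fintype B] {W : Type*} [Group W]
    {M : CoxeterMatrix B} (cs : CoxeterSystem M W) (T : Finset B) :
    cs.growth (fun w => {i : B | cs.IsRightDescent w i} = ↑T) =
      ∑ U : Finset B with T ⊆ U, (-1 : PowerSeries ℚ) ^ (U.card - T.card) *
        cs.growth (fun w => ∀ i ∈ (U : Set B), cs.IsRightDescent w i) := by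
  ext n
  have hC : ∀ (k : ℕ) (f : PowerSeries ℚ), PowerSeries.coeff n ((-1) ^ k * f) =
      (-1) ^ k * PowerSeries.coeff n f := by
    intro k f
    rcases Nat.even_or_odd k with hk | hk <;> simp [hk.neg_one_pow]
  simp only [map_sum, hC, coeff_growth, Finset.card_filter, Nat.cast_sum, Nat.cast_ite,
    Nat.cast_one, Nat.cast_zero, Finset.mul_sum, mul_ite, mul_one, mul_zero]
  rw [Finset.sum_comm]
  refine Finset.sum_congr rfl fun w _ => ?_
  set D : Finset B := Finset.univ.filter (cs.IsRightDescent w) with hD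
  rw [← Finset.sum_filter, Finset.filter_filter,
    show Finset.univ.filter (fun U : Finset B =>
        T ⊆ U ∧ ∀ i ∈ (U : Set B), cs.IsRightDescent w i) = Finset.Icc T D by
      ext U
      simp [hD, Finset.subset_iff],
    Finset.sum_Icc_neg_one_pow_card_sub]
  refine if_congr ?_ rfl rfl
  rw [← Finset.coe_inj, hD, eq_comm]
  simp

open scoped Classical in
/-- **Steinberg's formula** `W^T(t)/W(t) = Σ_{U ⊇ T, U ∈ 𝒮} (-1)^{Card(U−T)}/W_U(t⁻¹)`,
in single-parameter power-series form.  Let `(W, S)` be a Coxeter system with `S` finite,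
`𝒮` the set of spherical subsets, `w_U` the longest element of `W_U` for spherical `U`
(encoded by `wlong`), and `In(w) = {s ∈ S : ℓ(ws) < ℓ(w)}`.  Then for each spherical `T`,
in `ℚ⟦t⟧`:
`Σ_{In(w)=T} t^{ℓ w} = Σ_{U ∈ 𝒮, T ⊆ U} (-1)^{Card U − Card T} t^{ℓ(w_U)} · W(t) · W_U(t)⁻¹`. -/
theorem steinberg_formula {B : Type*} [Fintype B] {W : Type*} [Group W]
    {M : CoxeterMatrix B} (cs : CoxeterSystem M W)
    (wlong : Finset B → W)
    (hwlong : ∀ U : Finset B,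
      ((Subgroup.closure (cs.simple '' ↑U) : Subgroup W) : Set W).Finite →
        wlong U ∈ Subgroup.closure (cs.simple '' ↑U) ∧
          ∀ v ∈ Subgroup.closure (cs.simple '' ↑U), cs.length v ≤ cs.length (wlong U))
    (T : Finset B)
    (hT : ((Subgroup.closure (cs.simple '' ↑T) : Subgroup W) : Set W).Finite) :
    PowerSeries.mk (fun n =>
        (Nat.card {w : W //
          {i : B | cs.length (w * cs.simple i) < cs.length w} = ↑T ∧
            cs.length w = n} : ℚ)) =
      ∑ U ∈ Finset.univ.filter (fun U : Finset B =>
          T ⊆ U ∧ ((Subgroup.closure (cs.simple '' ↑U) : Subgroup W) : Set W).Finite),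
        (-1 : PowerSeries ℚ) ^ (U.card - T.card) * PowerSeries.X ^ cs.length (wlong U) *
          PowerSeries.mk (fun n => (Nat.card {w : W // cs.length w = n} : ℚ)) *
          (PowerSeries.mk (fun n =>
            (Nat.card {w : W //
              w ∈ Subgroup.closure (cs.simple '' ↑U) ∧ cs.length w = n} : ℚ)))⁻¹ := by
  have hN : (fun n => (Nat.card {w : W // cs.length w = n} : ℚ)) =
      fun n => (Nat.card {w : W // True ∧ cs.length w = n} : ℚ) := by simp
  rw [hN]
  change cs.growth (fun w => {i : B | cs.IsRightDescent w i} = ↑T) = ∑ U ∈ _,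
    (-1) ^ (U.card - T.card) * PowerSeries.X ^ cs.length (wlong U) * cs.growth (fun _ => True) *
      (cs.growth (· ∈ cs.parabolic ↑U))⁻¹
  rw [cs.growth_rightDescents_eq, ← Finset.filter_filter]
  symm
  refine (Finset.sum_congr rfl fun U hU => ?_).trans (Finset.sum_filter_of_ne fun U _ hne => ?_)
  · rw [CoxeterSystem.growth_forall_isRightDescent (hwlong U (Finset.mem_filter.1 hU).2),
      CoxeterSystem.growth_isMinCoset]
    ring
  · by_contra hU
    exact hne (by rw [CoxeterSystem.growth_forall_isRightDescent_eq_zero hU, mul_zero])
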